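/- Let Y = {Y^n} be a Markov chain on a finite set 𝒴 whose transition matrix decomposes as a direct sum V = ⊕_{ξ=1}^r V_ξ of irreducible transition matrices V_ξ on disjoint irreducible classes 𝒴_ξ (no transient class), with weights w(ξ) = Pr(Y_1 ∈ 𝒴_ξ) induced by the initial distribution. Then the spectral sup-entropy, spectral inf-entropy, and entropy rate of Y are H̄(Y) = max{H^{V_ξ}(Y) : 1 ≤ ξ ≤ r, w(ξ) > 0}, H_(Y) = min{H^{V_ξ}(Y) : 1 ≤ ξ ≤ r, w(ξ) > 0}, and H(Y) = Σ_{ξ=1}^r w(ξ) H^{V_ξ}(Y). -/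

import Mathlib

open MeasureTheory Filter
open scoped ENNReal Classical

noncomputable section

namespace RNG

variable {𝒳 𝒴 : Type*}

/-- The length-`m` prefix of an infinite sequence, as a tuple. -/
def pre (ω : ℕ → 𝒳) (m : ℕ) : Fin m → 𝒳 := fun i => ω i

/-- The length-`m` prefix of an infinite sequence, as a list. -/
def preL (ω : ℕ → 𝒳) (m : ℕ) : List 𝒳 := (List.range m).map ω

/-- `P_{X^m}(x^m)` : the probability of the cylinder set of a finite string `x^m`,
for a process with law `μ`. -/
def cylP [MeasurableSpace 𝒳] (μ : Measure (ℕ → 𝒳)) {m : ℕ} (x : Fin m → 𝒳) : ℝ :=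
  (μ {ω | ∀ i : Fin m, ω i = x i}).toReal

/-- Validity (exact generation) of an algorithm `φ` (given as a full-tree function on finite
coin strings, `none` playing the role of `⊥`): for every target value `y`, the probability
that the algorithm terminates with output `y` equals `PY y`. -/
def Valid {B : Type*} [MeasurableSpace 𝒳] (μ : Measure (ℕ → 𝒳)) (PY : B → ℝ)
    (φ : List 𝒳 → Option B) : Prop :=
  ∀ y : B,
    (μ {ω | ∃ i : ℕ, φ (preL ω i) = some y ∧ ∀ j < i, φ (preL ω j) = none}).toReal = PY y

/-- Strict lexicographic order on strings. -/
def lexLt [LT 𝒳] {m : ℕ} (x' x : Fin m → 𝒳) : Prop :=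
  ∃ i : Fin m, (∀ j : Fin m, j < i → x' j = x j) ∧ x' i < x i

/-- The subinterval of `[0,1)` assigned to the string `x` by the interval algorithm:
strings are arranged in lexicographic order, `x` receiving an interval of length `P x`. -/
def itv [LT 𝒳] [Fintype 𝒳] {m : ℕ} (P : (Fin m → 𝒳) → ℝ) (x : Fin m → 𝒳) : Set ℝ :=
  Set.Ico (∑ x' ∈ Finset.univ.filter (fun x' => lexLt x' x), P x')
    ((∑ x' ∈ Finset.univ.filter (fun x' => lexLt x' x), P x') + P x)

/-- The interval algorithm generating `Y^n` (target law `ν`) from the coin process `μ`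
has stopped after at most `m` coin symbols on the sample `ω`, i.e. the coin interval
`I_{x^m}` is contained in some target interval `J_{y^n}`. -/
def IntStopped [LinearOrder 𝒳] [Fintype 𝒳] [LinearOrder 𝒴] [Fintype 𝒴]
    [MeasurableSpace 𝒳] [MeasurableSpace 𝒴]
    (μ : Measure (ℕ → 𝒳)) (ν : Measure (ℕ → 𝒴)) (n m : ℕ) (ω : ℕ → 𝒳) : Prop :=
  ∃ y : Fin n → 𝒴, itv (fun x : Fin m → 𝒳 => cylP μ x) (pre ω m)
      ⊆ itv (fun y' : Fin n → 𝒴 => cylP ν y') y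

/-- A rate `R` is achievable by the interval algorithm:
`Pr(T_n > nR) → 0` (the stopping time `T_n` is `ℕ`-valued, so `T_n > nR ↔ T_n > ⌊nR⌋`). -/
def IntAchievable [LinearOrder 𝒳] [Fintype 𝒳] [LinearOrder 𝒴] [Fintype 𝒴]
    [MeasurableSpace 𝒳] [MeasurableSpace 𝒴]
    (μ : Measure (ℕ → 𝒳)) (ν : Measure (ℕ → 𝒴)) (R : ℝ) : Prop :=
  0 ≤ R ∧ Tendsto (fun n : ℕ =>
      (μ {ω | ¬ IntStopped μ ν n ⌊(n : ℝ) * R⌋₊ ω}).toReal) atTop (nhds 0)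

/-- `R⋆_int(X,Y)` : the infimum rate achievable by the interval algorithm. -/
def Rint [LinearOrder 𝒳] [Fintype 𝒳] [LinearOrder 𝒴] [Fintype 𝒴]
    [MeasurableSpace 𝒳] [MeasurableSpace 𝒴]
    (μ : Measure (ℕ → 𝒳)) (ν : Measure (ℕ → 𝒴)) : ℝ :=
  sInf {R : ℝ | IntAchievable μ ν R}

/-- A rate `R` is achievable by some sequence of valid algorithms: for each `n` there is a
valid algorithm `φ n` generating `Y^n` and `Pr(T_n > nR) → 0`. -/
def Achievable [MeasurableSpace 𝒳] [MeasurableSpace 𝒴]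
    (μ : Measure (ℕ → 𝒳)) (ν : Measure (ℕ → 𝒴)) (R : ℝ) : Prop :=
  0 ≤ R ∧ ∃ φ : (n : ℕ) → List 𝒳 → Option (Fin n → 𝒴),
    (∀ n : ℕ, Valid μ (fun y : Fin n → 𝒴 => cylP ν y) (φ n)) ∧
    Tendsto (fun n : ℕ =>
      (μ {ω | ∀ i ≤ ⌊(n : ℝ) * R⌋₊, φ n (preL ω i) = none}).toReal) atTop (nhds 0)

/-- `R⋆(X,Y)` : the infimum rate achievable over all valid algorithms. -/
def Rstar [MeasurableSpace 𝒳] [MeasurableSpace 𝒴]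
    (μ : Measure (ℕ → 𝒳)) (ν : Measure (ℕ → 𝒴)) : ℝ :=
  sInf {R : ℝ | Achievable μ ν R}

/-- The expected stopping time `E[T_n]` of the interval algorithm, via `E[T] = ∑_m Pr(T>m)`. -/
def intAvgT [LinearOrder 𝒳] [Fintype 𝒳] [LinearOrder 𝒴] [Fintype 𝒴]
    [MeasurableSpace 𝒳] [MeasurableSpace 𝒴]
    (μ : Measure (ℕ → 𝒳)) (ν : Measure (ℕ → 𝒴)) (n : ℕ) : ℝ≥0∞ :=
  ∑' m : ℕ, μ {ω | ¬ IntStopped μ ν n m ω}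

/-- A rate `L` is average achievable by the interval algorithm: `limsup E[T_n]/n ≤ L`. -/
def IntAvgAchievable [LinearOrder 𝒳] [Fintype 𝒳] [LinearOrder 𝒴] [Fintype 𝒴]
    [MeasurableSpace 𝒳] [MeasurableSpace 𝒴]
    (μ : Measure (ℕ → 𝒳)) (ν : Measure (ℕ → 𝒴)) (L : ℝ≥0∞) : Prop :=
  limsup (fun n : ℕ => intAvgT μ ν n / (n : ℝ≥0∞)) atTop ≤ L

/-- `L⋆_int(X,Y)` : the infimum average achievable rate of the interval algorithm. -/
def Lint [LinearOrder 𝒳] [Fintype 𝒳] [LinearOrder 𝒴] [Fintype 𝒴]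
    [MeasurableSpace 𝒳] [MeasurableSpace 𝒴]
    (μ : Measure (ℕ → 𝒳)) (ν : Measure (ℕ → 𝒴)) : ℝ≥0∞ :=
  sInf {L : ℝ≥0∞ | IntAvgAchievable μ ν L}

/-- A rate `L` is average achievable by some sequence of valid algorithms. -/
def AvgAchievable [MeasurableSpace 𝒳] [MeasurableSpace 𝒴]
    (μ : Measure (ℕ → 𝒳)) (ν : Measure (ℕ → 𝒴)) (L : ℝ≥0∞) : Prop :=
  ∃ φ : (n : ℕ) → List 𝒳 → Option (Fin n → 𝒴),
    (∀ n : ℕ, Valid μ (fun y : Fin n → 𝒴 => cylP ν y) (φ n)) ∧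
    limsup (fun n : ℕ =>
      (∑' m : ℕ, μ {ω | ∀ i ≤ m, φ n (preL ω i) = none}) / (n : ℝ≥0∞)) atTop ≤ L

/-- `L⋆(X,Y)` : the infimum average achievable rate over all valid algorithms. -/
def Lstar [MeasurableSpace 𝒳] [MeasurableSpace 𝒴]
    (μ : Measure (ℕ → 𝒳)) (ν : Measure (ℕ → 𝒴)) : ℝ≥0∞ :=
  sInf {L : ℝ≥0∞ | AvgAchievable μ ν L}

/-- The spectral sup-entropy `H̄(X)`: the event `(1/m) log(1/P_{X^m}(X^m)) ≥ λ` is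
`P_{X^m}(X^m) ≤ 2^{-mλ}`. -/
def specSup [MeasurableSpace 𝒳] (μ : Measure (ℕ → 𝒳)) : ℝ :=
  sInf {lam : ℝ | Tendsto (fun m : ℕ =>
    (μ {ω | cylP μ (pre ω m) ≤ (2 : ℝ) ^ (-((m : ℝ) * lam))}).toReal) atTop (nhds 0)}

/-- The spectral inf-entropy `H̲(X)`: the event `(1/m) log(1/P_{X^m}(X^m)) ≤ λ` is
`P_{X^m}(X^m) ≥ 2^{-mλ}`. -/
def specInf [MeasurableSpace 𝒳] (μ : Measure (ℕ → 𝒳)) : ℝ :=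
  sSup {lam : ℝ | Tendsto (fun m : ℕ =>
    (μ {ω | (2 : ℝ) ^ (-((m : ℝ) * lam)) ≤ cylP μ (pre ω m)}).toReal) atTop (nhds 0)}

/-- The (sup-)entropy rate `H(X) = limsup (1/m) H(X^m)`. -/
def entRate [MeasurableSpace 𝒳] [Fintype 𝒳] (μ : Measure (ℕ → 𝒳)) : ℝ :=
  limsup (fun m : ℕ =>
    (∑ x : Fin m → 𝒳, cylP μ x * Real.logb 2 (1 / cylP μ x)) / (m : ℝ)) atTop

/-- Upper-tail condition: `Pr((1/m) log(1/P_{X^m}(X^m)) ≥ H̄(X)+δ) ≤ K/m²` eventually. -/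
def UpperTail [MeasurableSpace 𝒳] (μ : Measure (ℕ → 𝒳)) : Prop :=
  ∀ δ : ℝ, 0 < δ → ∃ (K : ℝ) (m₀ : ℕ), ∀ m : ℕ, m₀ ≤ m →
    (μ {ω | cylP μ (pre ω m) ≤ (2 : ℝ) ^ (-((m : ℝ) * (specSup μ + δ)))}).toReal
      ≤ K / (m : ℝ) ^ 2

/-- Lower-tail condition: `Pr((1/m) log(1/P_{X^m}(X^m)) ≤ H̲(X)−δ) ≤ K/m²` eventually. -/
def LowerTail [MeasurableSpace 𝒳] (μ : Measure (ℕ → 𝒳)) : Prop :=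
  ∀ δ : ℝ, 0 < δ → ∃ (K : ℝ) (m₀ : ℕ), ∀ m : ℕ, m₀ ≤ m →
    (μ {ω | (2 : ℝ) ^ (-((m : ℝ) * (specInf μ - δ))) ≤ cylP μ (pre ω m)}).toReal
      ≤ K / (m : ℝ) ^ 2

/-- The finite-dimensional distributions of a Markov chain with initial distribution `q`
and transition matrix `W` (`W x x'` is the transition probability from `x` to `x'`). -/
def markovP (q : 𝒳 → ℝ) (W : 𝒳 → 𝒳 → ℝ) : (m : ℕ) → (Fin m → 𝒳) → ℝ
  | 0, _ => 1
  | m + 1, x => q (x 0) * ∏ i : Fin m, W (x i.castSucc) (x i.succ)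

/-- `μ` is the law of the Markov chain with initial distribution `q` and transition matrix `W`. -/
def IsMarkovMeasure [MeasurableSpace 𝒳] (μ : Measure (ℕ → 𝒳)) (q : 𝒳 → ℝ)
    (W : 𝒳 → 𝒳 → ℝ) : Prop :=
  ∀ (m : ℕ) (x : Fin m → 𝒳), cylP μ x = markovP q W m x

/-- `W` is a (row-)stochastic transition matrix. -/
def IsTransMat [Fintype 𝒳] (W : 𝒳 → 𝒳 → ℝ) : Prop :=
  (∀ x x', 0 ≤ W x x') ∧ ∀ x, ∑ x', W x x' = 1

/-- Irreducibility: any state reaches any other in some `k ≥ 1` steps. -/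
def IrreducibleMat [Fintype 𝒳] [DecidableEq 𝒳] (W : Matrix 𝒳 𝒳 ℝ) : Prop :=
  ∀ x x' : 𝒳, ∃ k : ℕ, 1 ≤ k ∧ 0 < (W ^ k) x x'

/-- `π` is a stationary distribution of `W`. -/
def IsStationary [Fintype 𝒳] (π : 𝒳 → ℝ) (W : 𝒳 → 𝒳 → ℝ) : Prop :=
  (∀ x, 0 ≤ π x) ∧ (∑ x, π x = 1) ∧ ∀ x, ∑ x', π x' * W x' x = π x

/-- `q` is a probability distribution (initial distribution). -/
def IsInitial [Fintype 𝒳] (q : 𝒳 → ℝ) : Prop :=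
  (∀ x, 0 ≤ q x) ∧ ∑ x, q x = 1

/-- The entropy rate `H^W(X) = Σ_{x',x} π(x') W(x|x') log (1/W(x|x'))` of a stationary
Markov chain. -/
def matEnt [Fintype 𝒳] (π : 𝒳 → ℝ) (W : 𝒳 → 𝒳 → ℝ) : ℝ :=
  ∑ x' : 𝒳, ∑ x : 𝒳, π x' * W x' x * Real.logb 2 (1 / W x' x)

/-- The weight `w(ξ) = Pr(Y_1 ∈ 𝒴_ξ)` of the irreducible class `ξ` under the initial
distribution `q`, where `c` assigns to each state its class. -/
def wgt [Fintype 𝒴] {r : ℕ} (c : 𝒴 → Fin r) (q : 𝒴 → ℝ) (ξ : Fin r) : ℝ :=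
  ∑ y ∈ Finset.univ.filter (fun y => c y = ξ), q y

/-- The binary entropy function (base 2). -/
def binEnt (t : ℝ) : ℝ := t * Real.logb 2 (1 / t) + (1 - t) * Real.logb 2 (1 / (1 - t))

end RNG

open RNG

namespace RNG

section Poisson

variable {𝒴 : Type*} [Fintype 𝒴] [DecidableEq 𝒴] {r : ℕ} {c : 𝒴 → Fin r} {V : Matrix 𝒴 𝒴 ℝ}

lemma pow_nonneg_of_isTransMat (hV : IsTransMat V) (k : ℕ) (y z : 𝒴) : 0 ≤ (V ^ k) y z := by
  induction k generalizing z with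
  | zero => rw [pow_zero, Matrix.one_apply]; split_ifs <;> norm_num
  | succ k ih =>
    rw [pow_succ, Matrix.mul_apply]
    exact Finset.sum_nonneg fun w _ => mul_nonneg (ih w) (hV.1 w z)

lemma pow_eq_zero_of_class_ne (hblock : ∀ y y' : 𝒴, c y ≠ c y' → V y y' = 0) (k : ℕ) {y z : 𝒴}
    (h : c y ≠ c z) : (V ^ k) y z = 0 := by
  induction k generalizing z with
  | zero => rw [pow_zero, Matrix.one_apply, if_neg]; rintro rfl; exact h rfl
  | succ k ih =>
    rw [pow_succ, Matrix.mul_apply]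
    refine Finset.sum_eq_zero fun w _ => ?_
    by_cases hw : c y = c w
    · rw [hblock w z (hw ▸ h), mul_zero]
    · rw [ih hw, zero_mul]

lemma pow_mulVec_eq_of_harmonic {g : 𝒴 → ℝ} (hg : V.mulVec g = g) (k : ℕ) :
    (V ^ k).mulVec g = g := by
  induction k with
  | zero => simp
  | succ k ih => rw [pow_succ, ← Matrix.mulVec_mulVec, hg, ih]

/-- A harmonic function is constant on every irreducible class (maximum principle). -/
lemma harmonic_eq_of_class_eq (hV : IsTransMat V)
    (hblock : ∀ y y' : 𝒴, c y ≠ c y' → V y y' = 0)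
    (hVirr : ∀ (ξ : Fin r) (y y' : 𝒴), c y = ξ → c y' = ξ → ∃ k : ℕ, 1 ≤ k ∧ 0 < (V ^ k) y y')
    {g : 𝒴 → ℝ} (hg : V.mulVec g = g) {y z : 𝒴} (hyz : c y = c z) : g y = g z := by
  obtain ⟨a, ha, hmax⟩ := Finset.exists_max_image
    (Finset.univ.filter fun w => c w = c z) g ⟨z, by simp⟩
  simp only [Finset.mem_filter, Finset.mem_univ, true_and] at ha hmax
  have hone : V.mulVec (fun _ => (1 : ℝ)) = fun _ => 1 := by
    ext w; simpa [Matrix.mulVec, dotProduct] using hV.2 w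
  have key : ∀ w, c w = c z → g w = g a := by
    intro w hw
    obtain ⟨k, -, hk⟩ := hVirr (c z) a w ha hw
    have h1 := congrFun (pow_mulVec_eq_of_harmonic hg k) a
    have h2 := congrFun (pow_mulVec_eq_of_harmonic hone k) a
    simp only [Matrix.mulVec, dotProduct, mul_one] at h1 h2
    have h3 : ∑ x, (V ^ k) a x * (g a - g x) = 0 := by
      simp only [mul_sub, Finset.sum_sub_distrib, ← Finset.sum_mul, h1, h2]; ring
    have h4 : ∀ x ∈ Finset.univ, 0 ≤ (V ^ k) a x * (g a - g x) := by
      intro x _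
      by_cases hx : c x = c z
      · exact mul_nonneg (pow_nonneg_of_isTransMat hV k a x) (sub_nonneg.2 (hmax x hx))
      · rw [pow_eq_zero_of_class_ne hblock k (by rw [ha]; exact Ne.symm hx), zero_mul]
    have h5 := (Finset.sum_eq_zero_iff_of_nonneg h4).1 h3 w (Finset.mem_univ w)
    rcases mul_eq_zero.1 h5 with h | h
    · exact absurd h hk.ne'
    · linarith
  rw [key y hyz, key z rfl]

/-- Solvability of the Poisson equation for a direct sum of irreducible transition matrices. -/
lemma exists_poisson_solution (hV : IsTransMat V)
    (hblock : ∀ y y' : 𝒴, c y ≠ c y' → V y y' = 0)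
    (hVirr : ∀ (ξ : Fin r) (y y' : 𝒴), c y = ξ → c y' = ξ → ∃ k : ℕ, 1 ≤ k ∧ 0 < (V ^ k) y y')
    {π : Fin r → 𝒴 → ℝ} (hπ : ∀ ξ, IsStationary (π ξ) V)
    (hsupp : ∀ (ξ : Fin r) (y : 𝒴), c y ≠ ξ → π ξ y = 0) (h : 𝒴 → ℝ) :
    ∃ f : 𝒴 → ℝ, ∀ y, h y = ∑ z, π (c y) z * h z + f y - ∑ z, V y z * f z := by
  set L : (𝒴 → ℝ) →ₗ[ℝ] (𝒴 → ℝ) := LinearMap.id - V.mulVecLin with hL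
  have hLapp : ∀ f y, L f y = f y - ∑ z, V y z * f z := fun f y => by
    simp [hL, Matrix.mulVec, dotProduct]
  have hker : ∀ g ∈ LinearMap.ker L, V.mulVec g = g := by
    intro g hg
    ext y
    have := congrFun (LinearMap.mem_ker.1 hg) y
    rw [hLapp, Pi.zero_apply] at this
    simp only [Matrix.mulVec, dotProduct]
    linarith
  have hmean_range : ∀ f ξ, ∑ y, π ξ y * L f y = 0 := by
    intro f ξ
    simp only [hLapp, mul_sub, Finset.sum_sub_distrib, Finset.mul_sum]
    rw [Finset.sum_comm, sub_eq_zero]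
    refine Finset.sum_congr rfl fun y _ => ?_
    simp only [← mul_assoc, ← Finset.sum_mul, (hπ ξ).2.2 y]
  have hmean_ker : ∀ g ∈ LinearMap.ker L, ∀ y, ∑ z, π (c y) z * g z = g y := by
    intro g hg y
    rw [← one_mul (g y), ← (hπ (c y)).2.1, Finset.sum_mul]
    refine Finset.sum_congr rfl fun z _ => ?_
    by_cases hz : c z = c y
    · rw [harmonic_eq_of_class_eq hV hblock hVirr (hker g hg) hz]
    · rw [hsupp _ _ hz]; simp
  have hdisj : Disjoint (LinearMap.ker L) (LinearMap.range L) := by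
    rw [Submodule.disjoint_def]
    rintro g hg ⟨f, rfl⟩
    ext y
    rw [← hmean_ker _ hg y, hmean_range, Pi.zero_apply]
  have htop : LinearMap.ker L ⊔ LinearMap.range L = ⊤ := by
    apply Submodule.eq_top_of_disjoint _ _ _ hdisj
    rw [add_comm]
    exact (LinearMap.finrank_range_add_finrank_ker L).ge
  obtain ⟨g, hg, _, ⟨f, rfl⟩, hgf⟩ := Submodule.mem_sup.1 (htop ▸ Submodule.mem_top : h ∈ _)
  refine ⟨f, fun y => ?_⟩
  have h1 : ∑ z, π (c y) z * h z = g y := by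
    rw [← hgf]
    simp only [Pi.add_apply, mul_add, Finset.sum_add_distrib, hmean_ker g hg, hmean_range, add_zero]
  rw [h1, ← hgf, Pi.add_apply, hLapp]
  ring

end Poisson

section Paths

variable {𝒴 : Type*} {q : 𝒴 → ℝ} {V : 𝒴 → 𝒴 → ℝ}

lemma markovP_snoc (n : ℕ) (x : Fin (n + 1) → 𝒴) (y : 𝒴) :
    markovP q V (n + 2) (Fin.snoc (α := fun _ => 𝒴) x y)
      = markovP q V (n + 1) x * V (x (Fin.last n)) y := by
  have h0 : (Fin.snoc (α := fun _ => 𝒴) x y : Fin (n + 2) → 𝒴) 0 = x 0 :=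
    Fin.snoc_castSucc (α := fun _ => 𝒴) y x 0
  simp only [markovP, Fin.prod_univ_castSucc, h0, Fin.succ_castSucc, Fin.snoc_castSucc,
    Fin.succ_last, Fin.snoc_last]
  ring

lemma markovP_nonneg (hq : ∀ y, 0 ≤ q y) (hV : ∀ y z, 0 ≤ V y z) (m : ℕ) (x : Fin m → 𝒴) :
    0 ≤ markovP q V m x := by
  cases m with
  | zero => exact zero_le_one
  | succ n => exact mul_nonneg (hq _) (Finset.prod_nonneg fun i _ => hV _ _)

/-- The additive functional of the transitions of a path. -/
def transSum (D : 𝒴 → 𝒴 → ℝ) {n : ℕ} (x : Fin (n + 1) → 𝒴) : ℝ :=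
  ∑ i : Fin n, D (x i.castSucc) (x i.succ)

lemma transSum_snoc (D : 𝒴 → 𝒴 → ℝ) {n : ℕ} (x : Fin (n + 1) → 𝒴) (y : 𝒴) :
    transSum D (Fin.snoc (α := fun _ => 𝒴) x y) = transSum D x + D (x (Fin.last n)) y := by
  simp only [transSum, Fin.sum_univ_castSucc, Fin.succ_castSucc, Fin.snoc_castSucc,
    Fin.succ_last, Fin.snoc_last]

/-- Along a path of positive probability the information density is, up to boundary terms,
linear with slope given by the class, plus a martingale. -/
lemma neg_logb_markovP {k f : 𝒴 → ℝ} {D : 𝒴 → 𝒴 → ℝ}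
    (hk : ∀ y z, V y z ≠ 0 → k y = k z)
    (hD : ∀ y z, D y z = Real.logb 2 (1 / V y z) - k y + f z - f y) (n : ℕ)
    (x : Fin (n + 1) → 𝒴) (hx : markovP q V (n + 1) x ≠ 0) :
    k (x (Fin.last n)) = k (x 0) ∧
    -Real.logb 2 (markovP q V (n + 1) x) = -Real.logb 2 (q (x 0)) + n * k (x 0) + transSum D x
      + f (x 0) - f (x (Fin.last n)) := by
  induction n with
  | zero => simp [markovP, transSum]
  | succ n ih =>
    obtain ⟨x, y, rfl⟩ : ∃ (x' : Fin (n + 1) → 𝒴) (y : 𝒴), x = Fin.snoc (α := fun _ => 𝒴) x' y :=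
      ⟨Fin.init x, x (Fin.last _), (Fin.snoc_init_self (α := fun _ => 𝒴) x).symm⟩
    have h0 : (Fin.snoc (α := fun _ => 𝒴) x y : Fin (n + 2) → 𝒴) 0 = x 0 :=
      Fin.snoc_castSucc (α := fun _ => 𝒴) y x 0
    rw [markovP_snoc] at hx
    have hx1 := left_ne_zero_of_mul hx
    have hx2 := right_ne_zero_of_mul hx
    obtain ⟨ih1, ih2⟩ := ih x hx1
    simp only [markovP_snoc, transSum_snoc, h0, Fin.snoc_last]
    refine ⟨by rw [← ih1, hk _ _ hx2], ?_⟩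
    rw [Real.logb_mul hx1 hx2, neg_add, ih2, hD, one_div, Real.logb_inv, ih1]
    push_cast
    ring

variable [Fintype 𝒴]

lemma sum_snoc {n : ℕ} (F : (Fin (n + 1) → 𝒴) → ℝ) :
    ∑ x, F x = ∑ x : Fin n → 𝒴, ∑ y, F (Fin.snoc (α := fun _ => 𝒴) x y) := by
  rw [← (Fin.snocEquiv fun _ : Fin (n + 1) => 𝒴).sum_comp, Fintype.sum_prod_type,
    Finset.sum_comm]
  rfl

lemma sum_markovP_mul_initial (hV : ∀ y, ∑ z, V y z = 1) (g : 𝒴 → ℝ) (n : ℕ) :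
    ∑ x, markovP q V (n + 1) x * g (x 0) = ∑ y, q y * g y := by
  induction n with
  | zero =>
    rw [← (Equiv.funUnique (Fin 1) 𝒴).symm.sum_comp]
    simp [markovP, Equiv.funUnique]
  | succ n ih =>
    rw [sum_snoc, ← ih]
    refine Finset.sum_congr rfl fun x _ => ?_
    have h0 : ∀ y, (Fin.snoc (α := fun _ => 𝒴) x y : Fin (n + 2) → 𝒴) 0 = x 0 := fun y =>
      Fin.snoc_castSucc (α := fun _ => 𝒴) y x 0
    simp only [markovP_snoc, h0]
    rw [← Finset.sum_mul, ← Finset.mul_sum, hV, mul_one]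

lemma sum_markovP (hq : ∑ y, q y = 1) (hV : ∀ y, ∑ z, V y z = 1) (n : ℕ) :
    ∑ x, markovP q V (n + 1) x = 1 := by
  simpa [hq] using sum_markovP_mul_initial (q := q) hV (fun _ => 1) n

/-- Second moment bound for sums of bounded martingale differences along the chain. -/
lemma sum_markovP_mul_transSum_sq_le (hq : IsInitial q) (hV : IsTransMat V) {D : 𝒴 → 𝒴 → ℝ}
    (hD : ∀ y, ∑ z, V y z * D y z = 0) {B : ℝ} (hB : ∀ y z, D y z ^ 2 ≤ B) (n : ℕ) :
    ∑ x, markovP q V (n + 1) x * transSum D x ^ 2 ≤ n * B := by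
  induction n with
  | zero => simp [transSum]
  | succ n ih =>
    have hstep : ∀ x : Fin (n + 1) → 𝒴,
        ∑ y, markovP q V (n + 2) (Fin.snoc (α := fun _ => 𝒴) x y)
          * transSum D (Fin.snoc (α := fun _ => 𝒴) x y) ^ 2
        ≤ markovP q V (n + 1) x * transSum D x ^ 2 + markovP q V (n + 1) x * B := by
      intro x
      set a := x (Fin.last n)
      set M := transSum D x
      have h1 : ∑ y, V a y * (M + D a y) ^ 2 ≤ M ^ 2 + B := by
        calc ∑ y, V a y * (M + D a y) ^ 2
            = M ^ 2 * ∑ y, V a y + 2 * M * ∑ y, V a y * D a y + ∑ y, V a y * D a y ^ 2 := by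
              simp only [Finset.mul_sum, ← Finset.sum_add_distrib]
              exact Finset.sum_congr rfl fun y _ => by ring
          _ ≤ M ^ 2 + ∑ y, V a y * B := by
              rw [hV.2, hD, mul_one, mul_zero, add_zero]
              gcongr with y _
              · exact hV.1 a y
              · exact hB a y
          _ = M ^ 2 + B := by rw [← Finset.sum_mul, hV.2, one_mul]
      simp only [markovP_snoc, transSum_snoc, mul_assoc, ← Finset.mul_sum]
      rw [← mul_add]
      exact mul_le_mul_of_nonneg_left h1 (markovP_nonneg hq.1 hV.1 _ x)
    rw [sum_snoc]
    refine (Finset.sum_le_sum fun x _ => hstep x).trans ?_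
    rw [Finset.sum_add_distrib, ← Finset.sum_mul, sum_markovP hq.2 hV.2]
    push_cast
    linarith

/-- The information density deviates from `m * k` by `O(√m)` in mean square. -/
lemma exists_sum_markovP_mul_deviation_sq_le (hq : IsInitial q) (hV : IsTransMat V)
    {k f : 𝒴 → ℝ} (hk : ∀ y z, V y z ≠ 0 → k y = k z)
    (hf : ∀ y, ∑ z, V y z * Real.logb 2 (1 / V y z) = k y + f y - ∑ z, V y z * f z) :
    ∃ C : ℝ, ∀ n : ℕ, ∑ x, markovP q V (n + 1) x *
      (-Real.logb 2 (markovP q V (n + 1) x) - (n + 1 : ℕ) * k (x 0)) ^ 2 ≤ C * (n + 1 : ℕ) := by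
  set D : 𝒴 → 𝒴 → ℝ := fun y z => Real.logb 2 (1 / V y z) - k y + f z - f y with hD
  have hD0 : ∀ y, ∑ z, V y z * D y z = 0 := by
    intro y
    have : ∀ z, V y z * D y z
        = V y z * Real.logb 2 (1 / V y z) - V y z * (k y + f y) + V y z * f z := fun z => by
      simp only [hD]; ring
    simp only [this, Finset.sum_add_distrib, Finset.sum_sub_distrib, ← Finset.sum_mul, hV.2, hf]
    ring
  obtain ⟨B, hB⟩ : ∃ B, ∀ p : 𝒴 × 𝒴, D p.1 p.2 ^ 2 ≤ B := by
    obtain ⟨B, hB⟩ := (Set.finite_range fun p : 𝒴 × 𝒴 => D p.1 p.2 ^ 2).bddAbove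
    exact ⟨B, fun p => hB ⟨p, rfl⟩⟩
  set b : 𝒴 × 𝒴 → ℝ := fun p => -Real.logb 2 (q p.1) - k p.1 + f p.1 - f p.2 with hb
  obtain ⟨A, hA⟩ : ∃ A, ∀ p, b p ^ 2 ≤ A := by
    obtain ⟨A, hA⟩ := (Set.finite_range fun p => b p ^ 2).bddAbove
    exact ⟨A, fun p => hA ⟨p, rfl⟩⟩
  refine ⟨2 * |A| + 2 * |B|, fun n => ?_⟩
  have hpt : ∀ x, markovP q V (n + 1) x *
      (-Real.logb 2 (markovP q V (n + 1) x) - (n + 1 : ℕ) * k (x 0)) ^ 2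
      ≤ markovP q V (n + 1) x * (2 * A) + 2 * (markovP q V (n + 1) x * transSum D x ^ 2) := by
    intro x
    by_cases hx : markovP q V (n + 1) x = 0
    · simp [hx]
    have h1 := (neg_logb_markovP (D := D) hk (fun _ _ => rfl) n x hx).2
    have h2 : -Real.logb 2 (markovP q V (n + 1) x) - (n + 1 : ℕ) * k (x 0)
        = b (x 0, x (Fin.last n)) + transSum D x := by
      rw [h1]; simp only [hb]; push_cast; ring
    have h3 := hA (x 0, x (Fin.last n))
    have h4 : (b (x 0, x (Fin.last n)) + transSum D x) ^ 2 ≤ 2 * A + 2 * transSum D x ^ 2 := by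
      nlinarith [sq_nonneg (b (x 0, x (Fin.last n)) - transSum D x)]
    rw [h2]
    have := mul_le_mul_of_nonneg_left h4 (markovP_nonneg hq.1 hV.1 _ x)
    linarith
  refine (Finset.sum_le_sum fun x _ => hpt x).trans ?_
  rw [Finset.sum_add_distrib, ← Finset.sum_mul, sum_markovP hq.2 hV.2, ← Finset.mul_sum]
  have h5 := sum_markovP_mul_transSum_sq_le hq hV hD0 (fun y z => hB (y, z)) n
  have hn : (0 : ℝ) ≤ n := n.cast_nonneg
  have h6 : (n : ℝ) * B ≤ n * |B| := mul_le_mul_of_nonneg_left (le_abs_self B) hn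
  push_cast
  nlinarith [le_abs_self A, abs_nonneg A, abs_nonneg B, mul_nonneg hn (abs_nonneg A)]

end Paths

section Weights

variable {𝒴 : Type*} [Fintype 𝒴] {r : ℕ} {c : 𝒴 → Fin r} {H : Fin r → ℝ} {q : 𝒴 → ℝ}

lemma wgt_pos_of_pos (hq : IsInitial q) {y : 𝒴} (hy : 0 < q y) : 0 < wgt c q (c y) :=
  hy.trans_le (Finset.single_le_sum (f := q) (fun z _ => hq.1 z) (by simp))

lemma exists_wgt_pos (hq : IsInitial q) : ∃ ξ, 0 < wgt c q ξ := by
  obtain ⟨y, -, hy⟩ := Finset.exists_lt_of_sum_lt (s := (Finset.univ : Finset 𝒴))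
    (f := fun _ => (0 : ℝ)) (g := q) (by simp [hq.2])
  exact ⟨c y, wgt_pos_of_pos hq hy⟩

lemma finite_rates : {h : ℝ | ∃ ξ : Fin r, 0 < wgt c q ξ ∧ h = H ξ}.Finite :=
  (Set.finite_range H).subset fun _ ⟨ξ, _, hξ⟩ => ⟨ξ, hξ.symm⟩

lemma sum_mul_class_eq (q : 𝒴 → ℝ) : ∑ y, q y * H (c y) = ∑ ξ, wgt c q ξ * H ξ := by
  rw [← Finset.sum_fiberwise (s := Finset.univ) (g := c)]
  refine Finset.sum_congr rfl fun ξ _ => ?_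
  rw [wgt, Finset.sum_mul]
  exact Finset.sum_congr rfl fun y hy => by rw [(Finset.mem_filter.1 hy).2]

end Weights

section Typical

lemma rpow_two_le_rpow_two {m : ℕ} {a b : ℝ} (hab : a ≤ b) :
    (2 : ℝ) ^ (-((m : ℝ) * b)) ≤ (2 : ℝ) ^ (-((m : ℝ) * a)) :=
  Real.rpow_le_rpow_of_exponent_le one_le_two
    (neg_le_neg (mul_le_mul_of_nonneg_left hab m.cast_nonneg))

variable {𝒴 : Type*} [MeasurableSpace 𝒴] {ν : Measure (ℕ → 𝒴)} {q : 𝒴 → ℝ} {V : 𝒴 → 𝒴 → ℝ}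

/-- The event that the information density of the prefix is not within `m * ε` of `m * k`. -/
def atypical (ν : Measure (ℕ → 𝒴)) (k : 𝒴 → ℝ) (ε : ℝ) (m : ℕ) : Set (ℕ → 𝒴) :=
  {ω | cylP ν (pre ω m) ≤ 0 ∨ m * ε ≤ |-Real.logb 2 (cylP ν (pre ω m)) - m * k (ω 0)|}

lemma rpow_lt_of_notMem_atypical {k : 𝒴 → ℝ} {ε : ℝ} {m : ℕ} {ω : ℕ → 𝒴}
    (h : ω ∉ atypical ν k ε m) :
    (2 : ℝ) ^ (-((m : ℝ) * (k (ω 0) + ε))) < cylP ν (pre ω m) ∧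
    cylP ν (pre ω m) < (2 : ℝ) ^ (-((m : ℝ) * (k (ω 0) - ε))) := by
  simp only [atypical, Set.mem_ofPred_eq, not_or, not_le, abs_lt] at h
  obtain ⟨h0, h1, h2⟩ := h
  constructor
  · rw [← Real.lt_logb_iff_rpow_lt one_lt_two h0]; linarith
  · rw [← Real.logb_lt_iff_lt_rpow one_lt_two h0]; linarith

variable [Fintype 𝒴]

lemma cylP_initial_pos_of_notMem_atypical {k : 𝒴 → ℝ} {ε : ℝ} {n : ℕ} {ω : ℕ → 𝒴}
    (hq : IsInitial q) (hν : IsMarkovMeasure ν q V)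
    (h : ω ∉ atypical ν k ε (n + 1)) : 0 < q (ω 0) := by
  simp only [atypical, Set.mem_ofPred_eq, not_or, not_le] at h
  have h1 := h.1
  rw [hν] at h1
  exact lt_of_le_of_ne (hq.1 _) (Ne.symm (left_ne_zero_of_mul h1.ne'))

lemma tendsto_zero_of_subset_atypical [IsFiniteMeasure ν] {r : ℕ} {c : 𝒴 → Fin r}
    {H : Fin r → ℝ} (hq : IsInitial q) (hν : IsMarkovMeasure ν q V)
    {ε : ℝ} {E : ℕ → Set (ℕ → 𝒴)}
    (htyp : Tendsto (fun m => ν.real (atypical ν (fun y => H (c y)) ε m)) atTop (nhds 0))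
    (hsub : ∀ m ω, 0 < wgt c q (c (ω 0)) → ω ∈ E m → ω ∈ atypical ν (fun y => H (c y)) ε m) :
    Tendsto (fun m => ν.real (E m)) atTop (nhds 0) := by
  rw [← tendsto_add_atTop_iff_nat 1] at htyp ⊢
  refine squeeze_zero (fun _ => measureReal_nonneg) (fun n => ?_) htyp
  refine measureReal_mono fun ω hω => ?_
  by_contra h
  exact h (hsub _ ω (wgt_pos_of_pos hq (cylP_initial_pos_of_notMem_atypical hq hν h)) hω)

lemma entRate_eq (hq : IsInitial q) (hV : IsTransMat V) (hν : IsMarkovMeasure ν q V)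
    {k : 𝒴 → ℝ} {C : ℝ}
    (hC : ∀ n : ℕ, ∑ x, markovP q V (n + 1) x *
      (-Real.logb 2 (markovP q V (n + 1) x) - (n + 1 : ℕ) * k (x 0)) ^ 2 ≤ C * (n + 1 : ℕ)) :
    entRate ν = ∑ y, q y * k y := by
  refine Tendsto.limsup_eq ?_
  rw [← tendsto_add_atTop_iff_nat 1, tendsto_iff_norm_sub_tendsto_zero]
  have hlim : Tendsto (fun n : ℕ => √(C * (1 / ((n : ℝ) + 1)))) atTop (nhds 0) := by
    simpa using (tendsto_one_div_add_atTop_nhds_zero_nat.const_mul C).sqrt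
  refine squeeze_zero (fun _ => norm_nonneg _) (fun n => ?_) hlim
  simp only [hν (n + 1)]
  set P := markovP q V (n + 1) with hP
  set R : (Fin (n + 1) → 𝒴) → ℝ := fun x => -Real.logb 2 (P x) - (n + 1 : ℕ) * k (x 0) with hR
  have hn : (0 : ℝ) < (n + 1 : ℕ) := by positivity
  have hmean : ∑ x, P x * Real.logb 2 (1 / P x)
      = ∑ x, P x * R x + (n + 1 : ℕ) * ∑ y, q y * k y := by
    rw [← sum_markovP_mul_initial (q := q) hV.2 k n, Finset.mul_sum, ← Finset.sum_add_distrib]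
    refine Finset.sum_congr rfl fun x _ => ?_
    simp only [hR, one_div, Real.logb_inv]
    ring
  have hjensen : (∑ x, P x * R x) ^ 2 ≤ ∑ x, P x * R x ^ 2 := by
    have h := (even_two.convexOn_pow (𝕜 := ℝ)).map_sum_le (t := Finset.univ) (w := P) (p := R)
      (fun x _ => markovP_nonneg hq.1 hV.1 _ x) (sum_markovP hq.2 hV.2 n) (fun _ _ => trivial)
    simpa using h
  rw [hmean, add_div, mul_div_cancel_left₀ _ hn.ne', add_sub_cancel_right, Real.norm_eq_abs]
  apply Real.abs_le_sqrt
  rw [div_pow, div_le_iff₀ (by positivity)]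
  refine hjensen.trans ((hC n).trans (le_of_eq ?_))
  push_cast
  field_simp

end Typical

section Law

variable {𝒴 : Type*} [Fintype 𝒴] [MeasurableSpace 𝒴] [DiscreteMeasurableSpace 𝒴]

lemma measureReal_pre_mem (ν : Measure (ℕ → 𝒴)) [IsFiniteMeasure ν] {m : ℕ}
    (s : Finset (Fin m → 𝒴)) : ν.real {ω | pre ω m ∈ s} = ∑ x ∈ s, cylP ν x := by
  have hmeas : Measurable fun ω : ℕ → 𝒴 => pre ω m :=
    measurable_pi_lambda _ fun i => measurable_pi_apply _
  have h := sum_measureReal_preimage_singleton (μ := ν) s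
    (f := fun ω : ℕ → 𝒴 => pre ω m) fun y _ => hmeas (measurableSet_singleton y)
  refine Eq.trans ?_ (h.symm.trans ?_)
  · rfl
  · refine Finset.sum_congr rfl fun x _ => ?_
    simp only [cylP, Measure.real]
    congr 2
    ext ω
    simp [funext_iff, pre]

variable {q : 𝒴 → ℝ} {V : 𝒴 → 𝒴 → ℝ} {ν : Measure (ℕ → 𝒴)} [IsProbabilityMeasure ν]

lemma measureReal_initial_mem (hV : IsTransMat V) (hν : IsMarkovMeasure ν q V) (s : Finset 𝒴) :
    ν.real {ω | ω 0 ∈ s} = ∑ y ∈ s, q y := by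
  have h := measureReal_pre_mem ν (m := 1) (Finset.univ.filter fun x => x 0 ∈ s)
  simp only [Finset.mem_filter, Finset.mem_univ, true_and] at h
  refine Eq.trans ?_ (h.trans ?_)
  · rfl
  · have := sum_markovP_mul_initial (q := q) hV.2 (fun y => if y ∈ s then 1 else 0) 0
    simp only [mul_ite, mul_one, mul_zero] at this
    rw [Finset.sum_filter]
    simp only [hν 1]
    refine this.trans ?_
    simp [Finset.sum_ite_mem]

lemma tendsto_measureReal_atypical (hq : IsInitial q) (hV : IsTransMat V)
    (hν : IsMarkovMeasure ν q V) {k : 𝒴 → ℝ} {C : ℝ}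
    (hC : ∀ n : ℕ, ∑ x, markovP q V (n + 1) x *
      (-Real.logb 2 (markovP q V (n + 1) x) - (n + 1 : ℕ) * k (x 0)) ^ 2 ≤ C * (n + 1 : ℕ))
    {ε : ℝ} (hε : 0 < ε) :
    Tendsto (fun m => ν.real (atypical ν k ε m)) atTop (nhds 0) := by
  rw [← tendsto_add_atTop_iff_nat 1]
  have hlim : Tendsto (fun n : ℕ => C / ε ^ 2 / ((n : ℝ) + 1)) atTop (nhds 0) := by
    have := (tendsto_one_div_add_atTop_nhds_zero_nat (𝕜 := ℝ)).const_mul (C / ε ^ 2)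
    rw [mul_zero] at this
    exact this.congr fun n => mul_one_div _ _
  refine squeeze_zero (fun _ => measureReal_nonneg) (fun n => ?_) hlim
  set P := markovP q V (n + 1) with hP
  set R : (Fin (n + 1) → 𝒴) → ℝ := fun x => -Real.logb 2 (P x) - (n + 1 : ℕ) * k (x 0) with hR
  have hset : atypical ν k ε (n + 1) = {ω | pre ω (n + 1) ∈
      Finset.univ.filter fun x => P x ≤ 0 ∨ (n + 1 : ℕ) * ε ≤ |R x|} := by
    ext ω
    simp only [atypical, hν (n + 1), Set.mem_ofPred_eq, Finset.mem_filter, Finset.mem_univ,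
      true_and, hR, hP]
    rfl
  rw [hset, measureReal_pre_mem]
  simp only [hν (n + 1)]
  have hn : (0 : ℝ) < (n + 1 : ℕ) := by positivity
  have hpos : 0 < ((n + 1 : ℕ) * ε) ^ 2 := by positivity
  have hcheb : (∑ x ∈ Finset.univ.filter (fun x => P x ≤ 0 ∨ (n + 1 : ℕ) * ε ≤ |R x|), P x)
      * ((n + 1 : ℕ) * ε) ^ 2 ≤ C * (n + 1 : ℕ) := by
    refine le_trans ?_ (hC n)
    rw [Finset.sum_mul]
    refine le_trans (Finset.sum_le_sum fun x hx => ?_) (Finset.sum_le_sum_of_subset_of_nonneg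
      (Finset.subset_univ _) fun x _ _ =>
        mul_nonneg (markovP_nonneg hq.1 hV.1 _ x) (sq_nonneg (R x)))
    have hPx := markovP_nonneg hq.1 hV.1 (n + 1) x
    rcases (Finset.mem_filter.1 hx).2 with h | h
    · have h0 : P x = 0 := le_antisymm h hPx
      rw [h0, zero_mul]
      exact mul_nonneg hPx (sq_nonneg _)
    · refine mul_le_mul_of_nonneg_left ?_ hPx
      rw [← sq_abs (R x)]
      gcongr
  calc _ ≤ C * (n + 1 : ℕ) / ((n + 1 : ℕ) * ε) ^ 2 := (le_div_iff₀ hpos).2 hcheb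
    _ = C / ε ^ 2 / ((n : ℝ) + 1) := by push_cast; field_simp

variable {r : ℕ} {c : 𝒴 → Fin r} {H : Fin r → ℝ}

lemma wgt_nonpos_of_tendsto (hV : IsTransMat V) (hν : IsMarkovMeasure ν q V)
    {ε : ℝ} {ξ : Fin r} {E : ℕ → Set (ℕ → 𝒴)}
    (htyp : Tendsto (fun m => ν.real (atypical ν (fun y => H (c y)) ε m)) atTop (nhds 0))
    (hE : Tendsto (fun m => ν.real (E m)) atTop (nhds 0))
    (hsub : ∀ m ω, c (ω 0) = ξ → ω ∉ atypical ν (fun y => H (c y)) ε m → ω ∈ E m) :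
    wgt c q ξ ≤ 0 := by
  have hw : wgt c q ξ = ν.real {ω | c (ω 0) = ξ} := by
    have := measureReal_initial_mem hV hν (Finset.univ.filter fun y => c y = ξ)
    simp only [Finset.mem_filter, Finset.mem_univ, true_and] at this
    exact this.symm
  refine ge_of_tendsto' (by simpa using htyp.add hE) fun m => ?_
  rw [hw]
  refine le_trans (measureReal_mono (fun ω hω => ?_))
    (measureReal_union_le (atypical ν (fun y => H (c y)) ε m) (E m))
  by_cases h : ω ∈ atypical ν (fun y => H (c y)) ε m
  · exact Or.inl h
  · exact Or.inr (hsub m ω hω h)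

lemma specSup_eq_of_typical (hq : IsInitial q) (hV : IsTransMat V) (hν : IsMarkovMeasure ν q V)
    (htyp : ∀ ε > 0, Tendsto (fun m => ν.real (atypical ν (fun y => H (c y)) ε m)) atTop (nhds 0)) :
    specSup ν = sSup {h : ℝ | ∃ ξ : Fin r, 0 < wgt c q ξ ∧ h = H ξ} := by
  obtain ⟨ξ₀, hξ₀⟩ := exists_wgt_pos (c := c) hq
  set T := {h : ℝ | ∃ ξ : Fin r, 0 < wgt c q ξ ∧ h = H ξ}
  have hT : BddAbove T := finite_rates.bddAbove
  set S := {lam : ℝ | Tendsto (fun m : ℕ =>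
    (ν {ω | cylP ν (pre ω m) ≤ (2 : ℝ) ^ (-((m : ℝ) * lam))}).toReal) atTop (nhds 0)}
  have hlow : ∀ lam ∈ S, ∀ h ∈ T, h ≤ lam := by
    rintro lam hlam _ ⟨ξ, hξ, rfl⟩
    by_contra! hlt
    refine hξ.not_ge (wgt_nonpos_of_tendsto hV hν (htyp _ (sub_pos.2 hlt)) hlam ?_)
    rintro m ω rfl h
    have := (rpow_lt_of_notMem_atypical h).2.le
    rwa [sub_sub_cancel] at this
  have hup : ∀ ε > 0, sSup T + ε ∈ S := by
    intro ε hε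
    refine tendsto_zero_of_subset_atypical hq hν (htyp ε hε) fun m ω hw hω => ?_
    by_contra h
    have h1 := (rpow_lt_of_notMem_atypical h).1
    have h2 : H (c (ω 0)) ≤ sSup T := le_csSup hT ⟨_, hw, rfl⟩
    exact absurd (h1.trans_le hω)
      (not_lt.2 (rpow_two_le_rpow_two (by simpa using add_le_add_left h2 ε)))
  refine le_antisymm (le_of_forall_pos_le_add fun ε hε =>
    csInf_le ⟨H ξ₀, fun lam hlam => hlow lam hlam _ ⟨ξ₀, hξ₀, rfl⟩⟩ (hup ε hε)) ?_
  exact csSup_le ⟨_, ξ₀, hξ₀, rfl⟩ fun h hh =>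
    le_csInf ⟨_, hup 1 one_pos⟩ fun lam hlam => hlow lam hlam h hh

lemma specInf_eq_of_typical (hq : IsInitial q) (hV : IsTransMat V) (hν : IsMarkovMeasure ν q V)
    (htyp : ∀ ε > 0, Tendsto (fun m => ν.real (atypical ν (fun y => H (c y)) ε m)) atTop (nhds 0)) :
    specInf ν = sInf {h : ℝ | ∃ ξ : Fin r, 0 < wgt c q ξ ∧ h = H ξ} := by
  obtain ⟨ξ₀, hξ₀⟩ := exists_wgt_pos (c := c) hq
  set T := {h : ℝ | ∃ ξ : Fin r, 0 < wgt c q ξ ∧ h = H ξ}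
  have hT : BddBelow T := finite_rates.bddBelow
  set S := {lam : ℝ | Tendsto (fun m : ℕ =>
    (ν {ω | (2 : ℝ) ^ (-((m : ℝ) * lam)) ≤ cylP ν (pre ω m)}).toReal) atTop (nhds 0)}
  have hup : ∀ lam ∈ S, ∀ h ∈ T, lam ≤ h := by
    rintro lam hlam _ ⟨ξ, hξ, rfl⟩
    by_contra! hlt
    refine hξ.not_ge (wgt_nonpos_of_tendsto hV hν (htyp _ (sub_pos.2 hlt)) hlam ?_)
    rintro m ω rfl h
    have := (rpow_lt_of_notMem_atypical h).1.le
    rwa [add_sub_cancel] at this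
  have hlow : ∀ ε > 0, sInf T - ε ∈ S := by
    intro ε hε
    refine tendsto_zero_of_subset_atypical hq hν (htyp ε hε) fun m ω hw hω => ?_
    by_contra h
    have h1 := (rpow_lt_of_notMem_atypical h).2
    have h2 : sInf T ≤ H (c (ω 0)) := csInf_le hT ⟨_, hw, rfl⟩
    exact absurd (lt_of_le_of_lt hω h1)
      (not_lt.2 (rpow_two_le_rpow_two (sub_le_sub_right h2 ε)))
  refine le_antisymm ?_ (le_of_forall_pos_le_add fun ε hε => sub_le_iff_le_add.1
    (le_csSup ⟨H ξ₀, fun lam hlam => hup lam hlam _ ⟨ξ₀, hξ₀, rfl⟩⟩ (hlow ε hε)))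
  exact csSup_le ⟨_, hlow 1 one_pos⟩ fun lam hlam =>
    le_csInf ⟨_, ξ₀, hξ₀, rfl⟩ fun h hh => hup lam hlam h hh

end Law

end RNG

/-- **Reducible Markov target.** Let `ν` be the law of a Markov chain on a finite set `𝒴`
whose transition matrix `V` is a direct sum of irreducible matrices on the classes
`𝒴_ξ = c⁻¹(ξ)` (no transient class), with stationary distributions `π ξ` supported on
`𝒴_ξ`, initial distribution `q`, and class weights `w(ξ) = Pr(Y_1 ∈ 𝒴_ξ)`.  Then
`H̄(Y) = max{H^{V_ξ} : w(ξ) > 0}`, `H̲(Y) = min{H^{V_ξ} : w(ξ) > 0}`, and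
`H(Y) = Σ_ξ w(ξ) H^{V_ξ}`. -/
theorem reducible_markov_spectrum
    {𝒴 : Type*} [Fintype 𝒴] [DecidableEq 𝒴] [MeasurableSpace 𝒴] [DiscreteMeasurableSpace 𝒴]
    (r : ℕ) (c : 𝒴 → Fin r) (V : Matrix 𝒴 𝒴 ℝ) (hV : IsTransMat V)
    (hblock : ∀ y y' : 𝒴, c y ≠ c y' → V y y' = 0)
    (hVirr : ∀ (ξ : Fin r) (y y' : 𝒴), c y = ξ → c y' = ξ →
      ∃ k : ℕ, 1 ≤ k ∧ 0 < (V ^ k) y y')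
    (π : Fin r → 𝒴 → ℝ) (hπ : ∀ ξ, IsStationary (π ξ) V)
    (hsupp : ∀ (ξ : Fin r) (y : 𝒴), c y ≠ ξ → π ξ y = 0)
    (q : 𝒴 → ℝ) (hq : IsInitial q)
    (ν : Measure (ℕ → 𝒴)) [IsProbabilityMeasure ν] (hν : IsMarkovMeasure ν q V) :
    specSup ν = sSup {h : ℝ | ∃ ξ : Fin r, 0 < wgt c q ξ ∧ h = matEnt (π ξ) V}
    ∧ specInf ν = sInf {h : ℝ | ∃ ξ : Fin r, 0 < wgt c q ξ ∧ h = matEnt (π ξ) V}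
    ∧ entRate ν = ∑ ξ : Fin r, wgt c q ξ * matEnt (π ξ) V := by
  set H : Fin r → ℝ := fun ξ => matEnt (π ξ) V with hH
  obtain ⟨f, hf⟩ := exists_poisson_solution hV hblock hVirr hπ hsupp
    fun y => ∑ z, V y z * Real.logb 2 (1 / V y z)
  have hent : ∀ ξ, ∑ y, π ξ y * ∑ z, V y z * Real.logb 2 (1 / V y z) = H ξ := fun ξ => by
    simp only [hH, matEnt, Finset.mul_sum, mul_assoc]
  simp only [hent] at hf
  have hk : ∀ y z, V y z ≠ 0 → H (c y) = H (c z) := fun y z hyz => by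
    rw [not_imp_comm.1 (hblock y z) hyz]
  obtain ⟨C, hC⟩ := exists_sum_markovP_mul_deviation_sq_le (k := fun y => H (c y)) hq hV hk hf
  have htyp : ∀ ε > 0, Tendsto (fun m => ν.real (atypical ν (fun y => H (c y)) ε m))
      atTop (nhds 0) := fun ε hε =>
    tendsto_measureReal_atypical (k := fun y => H (c y)) hq hV hν hC hε
  exact ⟨specSup_eq_of_typical hq hV hν htyp, specInf_eq_of_typical hq hV hν htyp,
    (entRate_eq (k := fun y => H (c y)) hq hV hν hC).trans (sum_mul_class_eq q)⟩
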